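/- arXiv:2009.09793 — 2 statements merged into one kernel-verified Lean document; each statement's English description precedes it below -/
import Mathlib

section
/- Let $D$ be a division ring, $f(x) \in D[x]$ a standard polynomial, $\lambda \in D$, and $n \geq 1$ a natural number. If $\lambda$ commutes with $f^{* t}(\lambda)$ (the $t$-fold iterate of the evaluation map $\mu \mapsto f(\mu)$ applied to $\lambda$) for every $t$ with $1 \leq t < n$, then $f^{\circ n}(\lambda) = f^{* n}(\lambda)$, i.e., the evaluation at $\lambda$ of the $n$-fold composition of $f$ equals the $n$-fold iterate of the evaluation map applied to $\lambda$. -/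
/-- `ocomp f n` is the `n`-fold self-composition `f^{∘n}` of the standard polynomial `f`,
defined by `f^{∘0} = x`, `f^{∘(n+1)} = f(f^{∘n}(x))` (so `f^{∘1} = f`). -/
noncomputable def ocomp {D : Type*} [DivisionRing D] (f : Polynomial D) : ℕ → Polynomial D
  | 0 => Polynomial.X
  | n + 1 => f.comp (ocomp f n)

open Polynomial in
/-- Evaluation at `a` is multiplicative on `p * q` as soon as `a` commutes with `q(a)`. -/
theorem Polynomial.eval_mul_of_commute_eval {R : Type*} [Semiring R] (p q : R[X]) {a : R}
    (h : Commute a (q.eval a)) : (p * q).eval a = p.eval a * q.eval a := by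
  induction p using Polynomial.induction_on' with
  | add p r hp hr => rw [add_mul, eval_add, eval_add, add_mul, hp, hr]
  | monomial n c =>
    rw [← C_mul_X_pow_eq_monomial, mul_assoc, X_pow_mul, eval_C_mul, eval_mul_X_pow,
      C_mul_X_pow_eq_monomial, eval_monomial, mul_assoc, (h.pow_left n).eq]

open Polynomial in
theorem Polynomial.eval_pow_of_commute_eval {R : Type*} [Semiring R] (q : R[X]) {a : R}
    (h : Commute a (q.eval a)) (n : ℕ) : (q ^ n).eval a = q.eval a ^ n := by
  induction n with
  | zero => simp
  | succ n ih => rw [pow_succ, eval_mul_of_commute_eval _ _ h, ih, pow_succ]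

open Polynomial in
theorem Polynomial.eval_comp_of_commute_eval {R : Type*} [Semiring R] (p q : R[X]) {a : R}
    (h : Commute a (q.eval a)) : (p.comp q).eval a = p.eval (q.eval a) := by
  induction p using Polynomial.induction_on' with
  | add p r hp hr => rw [add_comp, eval_add, eval_add, hp, hr]
  | monomial n c =>
    rw [monomial_comp, eval_C_mul, eval_pow_of_commute_eval _ h, eval_monomial]

/-- Let `D` be a division ring, `f ∈ D[x]`, `λ ∈ D` and `n ≥ 1`.
If `λ` commutes with `f^{*t}(λ)` (the `t`-fold iterate of the evaluation map applied to `λ`)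
for all `1 ≤ t < n`, then `f^{∘n}(λ) = f^{*n}(λ)`. -/
theorem eval_ocomp_eq_iterate_of_commute_iterate {D : Type*} [DivisionRing D]
    (f : Polynomial D) (lam : D) (n : ℕ) (hn : 1 ≤ n)
    (h : ∀ t : ℕ, 1 ≤ t → t < n → Commute lam ((fun mu : D => f.eval mu)^[t] lam)) :
    (ocomp f n).eval lam = (fun mu : D => f.eval mu)^[n] lam := by
  induction n, hn using Nat.le_induction with
  | base => simp [ocomp]
  | succ n hn ih =>
    have hev := ih fun t ht htn => h t ht (htn.trans n.lt_succ_self)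
    have hcomm := h n hn n.lt_succ_self
    rw [← hev] at hcomm
    rw [ocomp, Polynomial.eval_comp_of_commute_eval _ _ hcomm, hev,
      Function.iterate_succ_apply']
end

section
/- Let $D$ be a division ring, $f(x) \in D[x]$ a standard polynomial, $\lambda \in D$, and $r \geq 1$ a natural number such that $f^{\circ r}(\lambda) = \lambda$ and $\lambda$ commutes with $f^{* t}(\lambda)$ (the $t$-fold iterate of the evaluation map $\mu \mapsto f(\mu)$ applied to $\lambda$) for every $t$ with $1 \leq t < r$. Then $\lambda$ is an $r$-periodic point of $f(x)$, i.e., $f^{\circ (n r)}(\lambda) = \lambda$ for every $n \geq 1$, and moreover $\lambda$ commutes with $f^{\circ t}(\lambda)$ for every $t \geq 1$. -/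
namespace Polynomial

variable {R : Type*} [Semiring R]

theorem eval_mul_of_commute_eval_s5 {p q : R[X]} {x : R} (h : Commute x (q.eval x)) :
    (p * q).eval x = p.eval x * q.eval x := by
  induction p using Polynomial.induction_on' with
  | add p₁ p₂ h₁ h₂ => rw [add_mul, eval_add, eval_add, h₁, h₂, add_mul]
  | monomial n a =>
    rw [← C_mul_X_pow_eq_monomial, mul_assoc, X_pow_mul, eval_C_mul, eval_C_mul,
      eval_mul_X_pow, eval_X_pow, mul_assoc, (h.pow_left n).eq]

theorem eval_pow_of_commute_eval_s5 {q : R[X]} {x : R} (h : Commute x (q.eval x)) (n : ℕ) :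
    (q ^ n).eval x = q.eval x ^ n := by
  induction n with
  | zero => simp
  | succ n ih => rw [pow_succ, eval_mul_of_commute_eval_s5 h, ih, pow_succ]

theorem eval_comp_of_commute_eval_s5 {p q : R[X]} {x : R} (h : Commute x (q.eval x)) :
    (p.comp q).eval x = p.eval (q.eval x) := by
  induction p using Polynomial.induction_on' with
  | add p₁ p₂ h₁ h₂ => rw [add_comp, eval_add, eval_add, h₁, h₂]
  | monomial n a =>
    rw [monomial_comp, eval_C_mul, eval_pow_of_commute_eval_s5 h, eval_monomial]

end Polynomial

theorem ocomp_eval_eq_iterate {D : Type*} [DivisionRing D] (f : Polynomial D) (x : D) (n : ℕ)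
    (h : ∀ t < n, Commute x ((fun y : D => f.eval y)^[t] x)) :
    (ocomp f n).eval x = (fun y : D => f.eval y)^[n] x := by
  induction n with
  | zero => simp [ocomp]
  | succ n ih =>
    have hn := ih fun t ht => h t (ht.trans n.lt_succ_self)
    have hc : Commute x ((ocomp f n).eval x) := hn ▸ h n n.lt_succ_self
    rw [ocomp, Polynomial.eval_comp_of_commute_eval_s5 hc, hn, Function.iterate_succ_apply']

/-- Let `D` be a division ring, `f ∈ D[x]`, `λ ∈ D`, and `r ≥ 1` with
`f^{∘r}(λ) = λ` and `λ` commuting with `f^{*t}(λ)` (the `t`-fold iterate of the evaluation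
map applied to `λ`) for all `1 ≤ t < r`. Then `λ` is an `r`-periodic point of `f`
(`f^{∘(nr)}(λ) = λ` for all `n ≥ 1`), and `λ` commutes with `f^{∘t}(λ)` for all `t ≥ 1`. -/
theorem periodic_of_ocomp_eval_eq_of_commute_iterate {D : Type*} [DivisionRing D]
    (f : Polynomial D) (lam : D) (r : ℕ) (hr : 1 ≤ r)
    (hfix : (ocomp f r).eval lam = lam)
    (h : ∀ t : ℕ, 1 ≤ t → t < r → Commute lam ((fun mu : D => f.eval mu)^[t] lam)) :
    (∀ n : ℕ, 1 ≤ n → (ocomp f (n * r)).eval lam = lam) ∧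
      (∀ t : ℕ, 1 ≤ t → Commute lam ((ocomp f t).eval lam)) := by
  have hlt : ∀ t < r, Commute lam ((fun mu : D => f.eval mu)^[t] lam) := by
    intro t ht
    rcases Nat.eq_zero_or_pos t with rfl | h0
    · exact Commute.refl lam
    · exact h t h0 ht
  have hper : Function.IsPeriodicPt (fun mu : D => f.eval mu) r lam :=
    (ocomp_eval_eq_iterate f lam r hlt).symm.trans hfix
  have hcomm : ∀ t, Commute lam ((fun mu : D => f.eval mu)^[t] lam) := by
    intro t
    rw [← hper.iterate_mod_apply t]
    exact hlt _ (Nat.mod_lt t hr)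
  have hiter : ∀ t, (ocomp f t).eval lam = (fun mu : D => f.eval mu)^[t] lam :=
    fun t => ocomp_eval_eq_iterate f lam t fun s _ => hcomm s
  refine ⟨fun n _ => ?_, fun t _ => ?_⟩
  · rw [hiter]
    exact hper.const_mul n
  · rw [hiter]
    exact hcomm t
end
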